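/- The rank of the degree-n part of the free Lie algebra over ℚ on m generators equals the Witt number R(m,n) = (1/n) Σ_{d|n} μ(d)·m^{n/d}, where μ is the Möbius function. -/

import Mathlib

/-- The Witt number `R(m,n) = (1/n) * Σ_{d ∣ n} μ(d) * m^(n/d)`, with `μ` the Möbius
function. -/
noncomputable def wittR (m n : ℕ) : ℚ :=
  (1 / n : ℚ) * ∑ d ∈ n.divisors, (ArithmeticFunction.moebius d : ℚ) * (m : ℚ) ^ (n / d)

/-- The span of the generators of the free Lie algebra over `ℚ` on `m` generators. -/
noncomputable def lieGens (m : ℕ) : Submodule ℚ (FreeLieAlgebra ℚ (Fin m)) :=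
  Submodule.span ℚ (Set.range (FreeLieAlgebra.of ℚ (X := Fin m)))

/-- The degree `n` part `L_n` of the free Lie algebra over `ℚ` on `m` generators, graded
so that the generators have degree `1`: `L_1` is spanned by the generators and
`L_{n+2}` is spanned by the brackets `⁅x, y⁆` with `x ∈ L_1`, `y ∈ L_{n+1}`. -/
noncomputable def lieGrade (m : ℕ) : ℕ → Submodule ℚ (FreeLieAlgebra ℚ (Fin m))
  | 0 => ⊥
  | 1 => lieGens m
  | n + 2 => Submodule.span ℚ
      {z | ∃ x ∈ lieGens m, ∃ y ∈ lieGrade m (n + 1), z = ⁅x, y⁆}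


section WittWords

variable {α : Type*} [LinearOrder α]

theorem wcons_lt {a b : α} {u v : List α} : a :: u < b :: v ↔ a < b ∨ a = b ∧ u < v :=
  List.cons_lt_cons_iff

theorem wcons_le {a b : α} {u v : List α} : a :: u ≤ b :: v ↔ a < b ∨ a = b ∧ u ≤ v := by
  rw [← not_lt, wcons_lt, ← not_lt (a := v)]
  rcases lt_trichotomy a b with h | h | h
  · simp [h, h.not_gt, h.ne']
  · simp [h]
  · simp [h, h.not_gt, h.ne']

theorem wapp_lt (s : List α) {u v : List α} : s ++ u < s ++ v ↔ u < v := by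
  induction s with
  | nil => simp
  | cons a s ih => simp [ih]

theorem wlt_cases {u v : List α} (h : u < v) :
    (∃ t, t ≠ [] ∧ v = u ++ t) ∨ (∀ x y, u ++ x < v ++ y) := by
  induction u generalizing v with
  | nil =>
    left
    refine ⟨v, ?_, by simp⟩
    rintro rfl
    exact absurd h (lt_irrefl _)
  | cons a u ih =>
    cases v with
    | nil => exact absurd h (List.not_lt_nil _)
    | cons b v =>
      rcases wcons_lt.1 h with h1 | ⟨rfl, h1⟩
      · right
        intro x y
        exact wcons_lt.2 (Or.inl h1)
      · rcases ih h1 with ⟨t, ht, rfl⟩ | h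
        · left
          exact ⟨t, ht, by simp⟩
        · right
          intro x y
          exact wcons_lt.2 (Or.inr ⟨rfl, h x y⟩)

theorem wlt_app_of_length {u v : List α} (h : u < v) (hl : v.length ≤ u.length) (x y : List α) :
    u ++ x < v ++ y := by
  rcases wlt_cases h with ⟨t, ht, rfl⟩ | h
  · have := List.length_pos_iff.2 ht
    simp at hl
    exact absurd hl ht
  · exact h x y

/-- Lyndon words: strictly smaller than all proper nonempty suffixes. -/
def IsLyn (w : List α) : Prop :=
  w ≠ [] ∧ ∀ u v, u ≠ [] → v ≠ [] → w = u ++ v → w < v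

/-- The list of all shuffles of two words. -/
def merges {β : Type*} : List β → List β → List (List β)
  | [], v => [v]
  | u, [] => [u]
  | a :: u, b :: v => (merges u (b :: v)).map (a :: ·) ++ (merges (a :: u) v).map (b :: ·)

theorem merges_nil_left {β : Type*} (v : List β) : merges [] v = [v] := by
  simp [merges]

theorem merges_nil_right {β : Type*} (v : List β) : merges v [] = [v] := by
  cases v <;> simp [merges]

theorem merges_cons {β : Type*} (a b : β) (u v : List β) : merges (a :: u) (b :: v) =
    (merges u (b :: v)).map (a :: ·) ++ (merges (a :: u) v).map (b :: ·) := by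
  simp [merges]

theorem cons_mem_merges_left {β : Type*} (a : β) {u v z : List β} (h : z ∈ merges u v) :
    a :: z ∈ merges (a :: u) v := by
  cases v with
  | nil => simpa [merges_nil_right] using h
  | cons b v => simp [merges_cons, h]

theorem cons_mem_merges_right {β : Type*} (a : β) {u v z : List β} (h : z ∈ merges u v) :
    a :: z ∈ merges u (a :: v) := by
  cases u with
  | nil => simpa [merges_nil_left] using h
  | cons b v => simp [merges_cons, h]

theorem append_mem_merges {β : Type*} (u v : List β) : u ++ v ∈ merges u v := by
  induction u with
  | nil => simp [merges_nil_left]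
  | cons a u ih => exact cons_mem_merges_left a ih

theorem merges_ne_nil {β : Type*} (u v : List β) : ∃ z, z ∈ merges u v :=
  ⟨_, append_mem_merges u v⟩

/-- cases for membership -/
theorem mem_merges_cases {β : Type*} {u v z : List β} (h : z ∈ merges u v) :
    (u = [] ∧ v = [] ∧ z = []) ∨ (∃ a u' z', u = a :: u' ∧ z = a :: z' ∧ z' ∈ merges u' v) ∨
    (∃ b v' z', v = b :: v' ∧ z = b :: z' ∧ z' ∈ merges u v') := by
  cases u with
  | nil =>
    cases v with
    | nil => simpa [merges_nil_left] using h
    | cons b v =>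
      right; right
      exact ⟨b, v, v, rfl, by simpa [merges_nil_left] using h, by simp [merges_nil_left]⟩
  | cons a u =>
    cases v with
    | nil =>
      right; left
      exact ⟨a, u, u, rfl, by simpa [merges_nil_right] using h, by simp [merges_nil_right]⟩
    | cons b v =>
      right
      rw [merges_cons, List.mem_append, List.mem_map, List.mem_map] at h
      rcases h with ⟨z', hz, rfl⟩ | ⟨z', hz, rfl⟩
      · left; exact ⟨a, u, z', rfl, rfl, hz⟩
      · right; exact ⟨b, v, z', rfl, rfl, hz⟩

theorem merge_exchange (n : ℕ) : ∀ (x u v z : List α), x.length + u.length + v.length ≤ n →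
    v ≤ u → z ∈ merges (x ++ u) v → ∃ z' ∈ merges u (x ++ v), z ≤ z' := by
  induction n with
  | zero =>
    intro x u v z hl _ hz
    have h1 : x = [] := List.length_eq_zero_iff.1 (by omega)
    subst h1
    exact ⟨z, hz, le_rfl⟩
  | succ n ih =>
    intro x u v z hl huv hz
    rcases x with _ | ⟨a, x⟩
    · exact ⟨z, hz, le_rfl⟩
    rcases mem_merges_cases hz with ⟨h, _⟩ | ⟨a', u', z', h, rfl, hz'⟩ | ⟨b, v', z', rfl, rfl, hz'⟩
    · simp at h
    · simp at h
      obtain ⟨rfl, rfl⟩ := h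
      obtain ⟨z'', h1, h2⟩ := ih x u v z' (by simp at hl; omega) huv hz'
      exact ⟨a :: z'', cons_mem_merges_right a h1, wcons_le.2 (Or.inr ⟨rfl, h2⟩)⟩
    · rcases u with _ | ⟨c, u⟩
      · exact absurd huv (not_le.2 (List.nil_lt_cons _ _))
      rcases wcons_le.1 huv with h | ⟨rfl, h⟩
      · obtain ⟨z'', h2⟩ := merges_ne_nil u (a :: x ++ b :: v')
        exact ⟨c :: z'', cons_mem_merges_left c h2, wcons_le.2 (Or.inl h)⟩
      · obtain ⟨z'', h1, h2⟩ := ih (a :: x ++ [b]) u v' z' (by simp at hl ⊢; omega) h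
          (by simpa using hz')
        refine ⟨b :: z'', cons_mem_merges_left b ?_, wcons_le.2 (Or.inr ⟨rfl, h2⟩)⟩
        simpa using h1

theorem merge_le (u v : List α) (h : ∀ r s, u = r ++ s → s ≠ [] → v ≤ s) :
    ∀ z ∈ merges u v, z ≤ u ++ v := by
  induction u with
  | nil => intro z hz; simp [merges_nil_left] at hz; simp [hz]
  | cons a u ih =>
    have ih' := ih (fun r s hr hs => h (a :: r) s (by simp [hr]) hs)
    intro z hz
    rcases mem_merges_cases hz with ⟨h, _⟩ | ⟨a', u', z', h', rfl, hz'⟩ | ⟨b, v', z', rfl, rfl, hz'⟩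
    · simp at h
    · simp at h'
      obtain ⟨rfl, rfl⟩ := h'
      exact wcons_le.2 (Or.inr ⟨rfl, ih' _ hz'⟩)
    · rcases wcons_le.1 (h [] (a :: u) rfl (by simp)) with h1 | ⟨rfl, h1⟩
      · exact wcons_le.2 (Or.inl h1)
      · obtain ⟨z'', h2, h3⟩ := merge_exchange _ [b] u v' z' le_rfl h1 hz'
        exact wcons_le.2 (Or.inr ⟨rfl, h3.trans (ih' _ h2)⟩)

/-- The minimal nonempty suffix among those satisfying a predicate. -/
theorem exists_min_suffix (w : List α) (P : List α → Prop) (hP : ∃ u v, w = u ++ v ∧ P v) :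
    ∃ u v, w = u ++ v ∧ P v ∧ ∀ u' v', w = u' ++ v' → P v' → v ≤ v' := by
  classical
  let S : Finset (List α) := w.tails.toFinset.filter P
  have hS : S.Nonempty := by
    obtain ⟨u, v, rfl, h⟩ := hP
    exact ⟨v, by simp [S, h]⟩
  obtain ⟨v, hv, hmin⟩ := S.exists_min_image id hS
  simp only [S, Finset.mem_filter, List.mem_toFinset, List.mem_tails] at hv
  obtain ⟨⟨u, rfl⟩, h2⟩ := hv
  refine ⟨u, v, rfl, h2, ?_⟩
  intro u' v' h hv'
  exact hmin v' (by simp [S, hv', h])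

theorem not_lyn_split (w : List α) (hw : w ≠ []) (h : ¬ IsLyn w) :
    ∃ u v, u ≠ [] ∧ v ≠ [] ∧ w = u ++ v ∧ ∀ z ∈ merges u v, z ≤ w := by
  obtain ⟨u, v, rfl, hv, hmin⟩ := exists_min_suffix w (fun v => v ≠ []) ⟨[], w, by simp, hw⟩
  have hu : u ≠ [] := by
    rintro rfl
    apply h
    refine ⟨hw, fun u' v' hu' hv' he => ?_⟩
    refine lt_of_le_of_ne (hmin u' v' he hv') ?_
    intro h1
    have h2 := congrArg List.length he
    have := List.length_pos_iff.2 hu'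
    simp at h1 he
    simp [h1] at h2
    exact hu' h2
  refine ⟨u, v, hu, hv, rfl, ?_⟩
  apply merge_le
  rintro r s rfl hs
  by_contra hlt
  rw [not_le] at hlt
  have h1 : v ≤ s ++ v := hmin r (s ++ v) (by simp) (by simp [hs])
  rcases wlt_cases hlt with ⟨t, ht, h2⟩ | h2
  · have h3 : v ≤ t := hmin (r ++ s ++ s) t (by simp [← h2]) ht
    have h4 : t ≤ v := by
      by_contra h4
      rw [not_le] at h4
      have : s ++ v < s ++ t := (wapp_lt s).2 h4
      rw [← h2] at this
      exact absurd h1 (not_le.2 this)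
    have h5 := le_antisymm h3 h4
    have h6 := congrArg List.length h2
    have := List.length_pos_iff.2 hs
    rw [h5] at h6
    simp at h6
    exact hs h6
  · have := h2 v []
    simp at this
    exact absurd h1 (not_le.2 this)

theorem lyn_factor (w : List α) (h : IsLyn w) (hl : 2 ≤ w.length) :
    ∃ u v, w = u ++ v ∧ IsLyn u ∧ IsLyn v := by
  have hex : ∃ u v, w = u ++ v ∧ (v ≠ [] ∧ v ≠ w) := by
    rcases w with _ | ⟨a, _ | ⟨b, w⟩⟩
    · simp at hl
    · simp at hl
    · refine ⟨[a], b :: w, rfl, by simp, fun h => ?_⟩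
      have := congrArg List.length h
      simp at this
  obtain ⟨u, v, rfl, ⟨hv, hvw⟩, hmin⟩ := exists_min_suffix w (fun v => v ≠ [] ∧ v ≠ w) hex
  have hu : u ≠ [] := by rintro rfl; simp at hvw
  have hup := List.length_pos_iff.2 hu
  refine ⟨u, v, rfl, ⟨hu, ?_⟩, ⟨hv, ?_⟩⟩
  · rintro r s hr hs rfl
    have hrp := List.length_pos_iff.2 hr
    have hsp := List.length_pos_iff.2 hs
    by_contra hlt
    rw [not_lt] at hlt
    have hlt : s < r ++ s := lt_of_le_of_ne hlt (by
      intro h; have := congrArg List.length h; simp at this; exact hr this)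
    have h1 : r ++ s ++ v < s ++ v := h.2 r (s ++ v) hr (by simp [hs]) (by simp)
    rcases wlt_cases hlt with ⟨t, ht, h2⟩ | h2
    · rw [h2, List.append_assoc, wapp_lt] at h1
      have h4 : v ≤ t ++ v := by
        refine hmin s (t ++ v) (by simp [h2]) ⟨by simp [ht], ?_⟩
        intro h
        have := congrArg List.length h
        simp at this
        have h2 := congrArg List.length h2
        simp at h2
        omega
      exact absurd h4 (not_le.2 h1)
    · exact absurd h1 (not_lt.2 (h2 v v).le)
  · rintro r s hr hs rfl
    have hrp := List.length_pos_iff.2 hr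
    have := hmin (u ++ r) s (by simp) ⟨hs, by
      intro h; have := congrArg List.length h; simp at this; omega⟩
    refine lt_of_le_of_ne this ?_
    intro h; have := congrArg List.length h; simp at this; exact hr this

theorem lyn_iff_rot (w : List α) (hw : w ≠ []) :
    IsLyn w ↔ ∀ u v, u ≠ [] → v ≠ [] → w = u ++ v → w < v ++ u := by
  constructor
  · rintro ⟨_, h⟩ u v hu hv rfl
    have := wlt_app_of_length (h u v hu hv rfl) (by simp) [] u
    simpa using this
  · intro h
    refine ⟨hw, ?_⟩
    rintro u v hu hv rfl
    have h1 := h u v hu hv rfl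
    by_contra hlt
    rw [not_lt] at hlt
    have hlt : v < u ++ v := lt_of_le_of_ne hlt (by
      intro h; have := congrArg List.length h; simp at this; exact hu this)
    rcases wlt_cases hlt with ⟨t, ht, h2⟩ | h2
    · rw [h2, wapp_lt] at h1
      have h3 := congrArg List.length h2
      simp at h3
      have h4 : t ++ v < u ++ v := wlt_app_of_length h1 (by omega) v v
      have h5 := h v t hv ht h2
      exact absurd h4 (not_lt.2 h5.le)
    · have := h2 u []
      simp at this
      exact absurd h1 (not_lt.2 (by simpa using this.le))

end WittWords

section WittShuffle

variable {α : Type*} [DecidableEq α]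

/-- Sum of `f` over all shuffles of `u` and `v`. -/
def shuf {β : Type*} (f : List β → ℚ) (u v : List β) : ℚ := ((merges u v).map f).sum

theorem shuf_nil_left {β : Type*} (f : List β → ℚ) (v : List β) : shuf f [] v = f v := by
  simp [shuf, merges_nil_left]

theorem shuf_nil_right {β : Type*} (f : List β → ℚ) (v : List β) : shuf f v [] = f v := by
  simp [shuf, merges_nil_right]

theorem shuf_cons {β : Type*} (f : List β → ℚ) (a b : β) (u v : List β) :
    shuf f (a :: u) (b :: v) =
      shuf (fun w => f (a :: w)) u (b :: v) + shuf (fun w => f (b :: w)) (a :: u) v := by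
  simp [shuf, merges_cons, Function.comp_def]

theorem shuf_snoc {β : Type*} (a b : β) (u v : List β) : ∀ (f : List β → ℚ),
    shuf f (u ++ [a]) (v ++ [b]) =
      shuf (fun w => f (w ++ [a])) u (v ++ [b]) + shuf (fun w => f (w ++ [b])) (u ++ [a]) v := by
  induction u generalizing v with
  | nil =>
    induction v with
    | nil => intro f; simp [shuf_cons, shuf_nil_left, shuf_nil_right]; ring
    | cons d v ihv =>
      intro f
      have := ihv (fun w => f (d :: w))
      simp only [List.nil_append, List.cons_append, shuf_cons, shuf_nil_left] at this ⊢
      rw [this]; ring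
  | cons c u ihu =>
    induction v with
    | nil =>
      intro f
      have := ihu [] (fun w => f (c :: w))
      simp only [List.nil_append, List.cons_append, shuf_cons, shuf_nil_right] at this ⊢
      rw [this]; ring
    | cons d v ihv =>
      intro f
      have h1 := ihu (d :: v) (fun w => f (c :: w))
      have h2 := ihv (fun w => f (d :: w))
      simp only [List.cons_append, shuf_cons] at h1 h2 ⊢
      rw [h1, h2]; ring

theorem shuf_zero {β : Type*} (u v : List β) : shuf (fun _ => 0) u v = 0 := by
  simp [shuf]

theorem shuf_add {β : Type*} (f g : List β → ℚ) (u v : List β) :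
    shuf (fun w => f w + g w) u v = shuf f u v + shuf g u v := by
  simp [shuf, List.sum_map_add]

theorem shuf_smul {β : Type*} (c : ℚ) (f : List β → ℚ) (u v : List β) :
    shuf (fun w => c * f w) u v = c * shuf f u v := by
  simp [shuf, List.sum_map_mul_left]

/-- Left multiplication by a letter. -/
def lmulL (x : α) (f : List α → ℚ) : List α → ℚ
  | [] => 0
  | a :: w => if a = x then f w else 0

/-- Right multiplication by a letter. -/
def rmulL (x : α) (f : List α → ℚ) (w : List α) : ℚ := lmulL x (fun z => f z.reverse) w.reverse

theorem rmulL_snoc (x a : α) (f : List α → ℚ) (w : List α) :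
    rmulL x f (w ++ [a]) = if a = x then f w else 0 := by
  simp [rmulL, lmulL]

theorem shuf_ite {β : Type*} (P : Prop) [Decidable P] (f : List β → ℚ) (u v : List β) :
    shuf (fun w => if P then f w else 0) u v = if P then shuf f u v else 0 := by
  split_ifs <;> simp [shuf_zero]

theorem shuf_lmulL (x : α) (f : List α → ℚ)
    (hf : ∀ u v, u ≠ [] → v ≠ [] → shuf f u v = 0) (u v : List α) (hu : u ≠ []) (hv : v ≠ []) :
    shuf (lmulL x f) u v = (if u = [x] then f v else 0) + (if v = [x] then f u else 0) := by
  rcases u with _ | ⟨a, u⟩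
  · exact absurd rfl hu
  rcases v with _ | ⟨b, v⟩
  · exact absurd rfl hv
  rw [shuf_cons]
  simp only [lmulL]
  rw [shuf_ite, shuf_ite]
  congr 1
  · rcases u with _ | ⟨c, u⟩
    · simp [shuf_nil_left]
    · simp [hf (c :: u) (b :: v)]
  · rcases v with _ | ⟨c, v⟩
    · simp [shuf_nil_right]
    · simp [hf (a :: u) (c :: v)]

theorem shuf_rmulL (x : α) (f : List α → ℚ)
    (hf : ∀ u v, u ≠ [] → v ≠ [] → shuf f u v = 0) (u v : List α) (hu : u ≠ []) (hv : v ≠ []) :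
    shuf (rmulL x f) u v = (if u = [x] then f v else 0) + (if v = [x] then f u else 0) := by
  obtain ⟨u, a, rfl⟩ := List.eq_nil_or_concat' u |>.resolve_left hu
  obtain ⟨v, b, rfl⟩ := List.eq_nil_or_concat' v |>.resolve_left hv
  rw [shuf_snoc]
  simp only [rmulL_snoc]
  rw [shuf_ite, shuf_ite]
  congr 1
  · rcases u with _ | ⟨c, u⟩
    · simp [shuf_nil_left]
    · simp [hf (c :: u) (v ++ [b])]
  · rcases v with _ | ⟨c, v⟩
    · simp [shuf_nil_right]
    · simp [hf (u ++ [a]) (c :: v)]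

/-- If `f` kills proper shuffles, and `w` is a non-Lyndon word such that `f` vanishes on
smaller words, then `f w = 0`. -/
theorem shuf_lead {β : Type*} [LinearOrder β] (f : List β → ℚ)
    (hf : ∀ u v, u ≠ [] → v ≠ [] → shuf f u v = 0) (w : List β) (hw : w ≠ [])
    (hl : ¬ IsLyn w) (hsm : ∀ z, z.length = w.length → z < w → f z = 0) : f w = 0 := by
  obtain ⟨u, v, hu, hv, rfl, hm⟩ := not_lyn_split w hw hl
  have hlen : ∀ (n : ℕ) (u v : List β), u.length + v.length ≤ n → ∀ z ∈ merges u v,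
      z.length = u.length + v.length := by
    intro n
    induction n with
    | zero =>
      intro u v h z hz
      have h1 : u = [] := List.length_eq_zero_iff.1 (by omega)
      subst h1
      simp [merges_nil_left] at hz
      simp [hz]
    | succ n ih =>
      intro u v h z hz
      rcases mem_merges_cases hz with ⟨rfl, rfl, rfl⟩ | ⟨a, u', z', rfl, rfl, hz'⟩ |
        ⟨b, v', z', rfl, rfl, hz'⟩
      · rfl
      · have := ih u' v (by simp at h; omega) z' hz'
        simp; omega
      · have := ih u v' (by simp at h; omega) z' hz'
        simp; omega
  have h0 := hf u v hu hv
  have key : ∀ l : List (List β), (∀ z ∈ l, z ≤ u ++ v ∧ z.length = (u ++ v).length) →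
      ∃ k : ℕ, (l.map f).sum = k * f (u ++ v) ∧ (u ++ v ∈ l → 0 < k) := by
    intro l
    induction l with
    | nil => intro _; exact ⟨0, by simp⟩
    | cons z l ih =>
      intro h
      obtain ⟨k, hk, hk'⟩ := ih (fun z hz => h z (by simp [hz]))
      by_cases hz : z = u ++ v
      · exact ⟨k + 1, by simp [hk, hz]; ring, fun _ => by omega⟩
      · refine ⟨k, ?_, ?_⟩
        · have h1 := h z (by simp)
          simp [hk, hsm z h1.2 (lt_of_le_of_ne h1.1 hz)]
        · intro h
          rcases List.mem_cons.1 h with h | h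
          · exact absurd h.symm hz
          · exact hk' h
  obtain ⟨k, hk, hk'⟩ := key (merges u v)
    (fun z hz => ⟨hm z hz, by rw [hlen _ u v le_rfl z hz]; simp⟩)
  rw [shuf, hk] at h0
  have := hk' (append_mem_merges u v)
  rcases mul_eq_zero.1 h0 with h | h
  · norm_cast at h; omega
  · exact h

end WittShuffle

section WittAlg

attribute [local instance] LieRing.ofAssociativeRing

/-- The tensor algebra as a monoid algebra on words. -/
abbrev WT (m : ℕ) : Type := MonoidAlgebra ℚ (FreeMonoid (Fin m))

/-- Coefficient of a word. -/
noncomputable def cf {m : ℕ} (w : List (Fin m)) : WT m →ₗ[ℚ] ℚ where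
  toFun p := p.coeff (FreeMonoid.ofList w)
  map_add' p q := by simp
  map_smul' c p := by simp

theorem cf_def {m : ℕ} (w : List (Fin m)) (p : WT m) : cf w p = p.coeff (FreeMonoid.ofList w) := rfl

theorem cf_ext {m : ℕ} {p : WT m} (h : ∀ w, cf w p = 0) : p = 0 := by
  apply MonoidAlgebra.coeff_injective
  ext w
  exact h (FreeMonoid.toList w)

theorem cf_mul {m : ℕ} (p q : WT m) (w : List (Fin m)) :
    cf w (p * q) = ∑ i ∈ Finset.range (w.length + 1), cf (w.take i) p * cf (w.drop i) q := by
  classical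
  rw [cf_def, MonoidAlgebra.coeff_mul_antidiag p q _
    ((Finset.range (w.length + 1)).image
      (fun i => (FreeMonoid.ofList (w.take i), FreeMonoid.ofList (w.drop i))))]
  · rw [Finset.sum_image]
    · rfl
    · intro i hi j hj hij
      simp only [Prod.mk.injEq, EmbeddingLike.apply_eq_iff_eq] at hij
      have := congrArg List.length hij.1
      simp at this hi hj
      omega
  · rintro ⟨a, b⟩
    simp only [Finset.mem_image, Finset.mem_range, Prod.mk.injEq]
    constructor
    · rintro ⟨i, hi, rfl, rfl⟩
      rw [← FreeMonoid.ofList_append, List.take_append_drop]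
    · intro h
      have h' : FreeMonoid.toList a ++ FreeMonoid.toList b = w := by
        rw [← FreeMonoid.toList_mul, h, FreeMonoid.toList_ofList]
      refine ⟨(FreeMonoid.toList a).length, ?_, ?_, ?_⟩
      · rw [← h']; simp
      · rw [← h']; simp
      · rw [← h']; simp

/-- The generators. -/
noncomputable def WX {m : ℕ} (a : Fin m) : WT m := MonoidAlgebra.single (FreeMonoid.of a) 1

theorem cf_WX {m : ℕ} (a : Fin m) (w : List (Fin m)) : cf w (WX a) = if w = [a] then 1 else 0 := by
  classical
  rw [cf_def, WX, MonoidAlgebra.coeff_single_apply]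
  congr 1
  rw [eq_comm (a := w)]
  rfl

/-- Homogeneity. -/
def WHom {m : ℕ} (n : ℕ) (p : WT m) : Prop := ∀ w, w.length ≠ n → cf w p = 0

theorem cf_WX_mul {m : ℕ} (a : Fin m) (p : WT m) (w : List (Fin m)) :
    cf w (WX a * p) = lmulL a (fun z => cf z p) w := by
  rw [cf_mul]
  rcases w with _ | ⟨b, w⟩
  · simp [lmulL, cf_WX]
  · rw [Finset.sum_eq_single 1]
    · simp [lmulL, cf_WX]
    · intro i hi hi1
      rw [cf_WX, if_neg, zero_mul]
      intro h
      have := congrArg List.length h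
      simp at this hi
      omega
    · simp

theorem cf_mul_WX {m : ℕ} (a : Fin m) (p : WT m) (w : List (Fin m)) :
    cf w (p * WX a) = rmulL a (fun z => cf z p) w := by
  rw [cf_mul]
  rcases List.eq_nil_or_concat' w with rfl | ⟨w, b, rfl⟩
  · simp [lmulL, rmulL, cf_WX]
  · rw [Finset.sum_eq_single w.length, rmulL_snoc]
    · simp [cf_WX]
    · intro i hi hi1
      rw [cf_WX, if_neg, mul_zero]
      intro h
      have := congrArg List.length h
      simp at this hi
      omega
    · simp

theorem cf_mul_hom {m n : ℕ} (p q : WT m) (hp : WHom n p) (w : List (Fin m)) (hw : n ≤ w.length) :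
    cf w (p * q) = cf (w.take n) p * cf (w.drop n) q := by
  rw [cf_mul, Finset.sum_eq_single n]
  · intro i hi hin
    rw [hp, zero_mul]
    simp at hi ⊢
    omega
  · intro h
    simp at h
    omega

theorem WHom_mul {m n k : ℕ} {p q : WT m} (hp : WHom n p) (hq : WHom k q) : WHom (n + k) (p * q) := by
  intro w hw
  rw [cf_mul]
  apply Finset.sum_eq_zero
  intro i hi
  simp at hi
  by_cases h : i = n
  · rw [hq, mul_zero]
    simp; omega
  · rw [hp, zero_mul]
    simp; omega

theorem WHom_sub {m n : ℕ} {p q : WT m} (hp : WHom n p) (hq : WHom n q) : WHom n (p - q) := by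
  intro w hw
  rw [map_sub, hp w hw, hq w hw, sub_zero]

theorem WHom_WX {m : ℕ} (a : Fin m) : WHom 1 (WX a) := by
  intro w hw
  rw [cf_WX, if_neg]
  rintro rfl
  simp at hw

/-- The canonical map from the free Lie algebra to the tensor algebra. -/
noncomputable def wphi (m : ℕ) : FreeLieAlgebra ℚ (Fin m) →ₗ⁅ℚ⁆ WT m :=
  FreeLieAlgebra.lift ℚ (fun a => WX a)

theorem wphi_of {m : ℕ} (a : Fin m) : wphi m (FreeLieAlgebra.of ℚ a) = WX a := by
  simp [wphi]

theorem wphi_lie {m : ℕ} (x y : FreeLieAlgebra ℚ (Fin m)) :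
    wphi m ⁅x, y⁆ = wphi m x * wphi m y - wphi m y * wphi m x := by
  rw [LieHom.map_lie, LieRing.of_associative_ring_bracket]

theorem grade_ind_one {m : ℕ} {P : FreeLieAlgebra ℚ (Fin m) → Prop} (h0 : P 0)
    (hadd : ∀ x y, P x → P y → P (x + y)) (hsmul : ∀ (c : ℚ) x, P x → P (c • x))
    (h : ∀ a, P (FreeLieAlgebra.of ℚ a)) : ∀ z ∈ lieGrade m 1, P z := by
  intro z hz
  change z ∈ Submodule.span ℚ _ at hz
  induction hz using Submodule.span_induction with
  | mem x hx => obtain ⟨a, rfl⟩ := hx; exact h a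
  | zero => exact h0
  | add x y _ _ hx hy => exact hadd _ _ hx hy
  | smul c x _ hx => exact hsmul _ _ hx

theorem grade_ind_succ {m n : ℕ} {P : FreeLieAlgebra ℚ (Fin m) → Prop} (h0 : P 0)
    (hadd : ∀ x y, P x → P y → P (x + y)) (hsmul : ∀ (c : ℚ) x, P x → P (c • x))
    (h : ∀ a : Fin m, ∀ y ∈ lieGrade m (n + 1), P ⁅FreeLieAlgebra.of ℚ a, y⁆) :
    ∀ z ∈ lieGrade m (n + 2), P z := by
  intro z hz
  change z ∈ Submodule.span ℚ _ at hz
  induction hz using Submodule.span_induction with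
  | mem x hx =>
    obtain ⟨x, hx, y, hy, rfl⟩ := hx
    have hx' : x ∈ lieGrade m 1 := hx
    exact grade_ind_one (P := fun x => P ⁅x, y⁆) (by simpa using h0)
      (fun a b ha hb => by simpa using hadd _ _ ha hb)
      (fun c a ha => by simpa using hsmul c _ ha) (fun a => h a y hy) x hx'
  | zero => exact h0
  | add x y _ _ hx hy => exact hadd _ _ hx hy
  | smul c x _ hx => exact hsmul _ _ hx

theorem lie_mem_one {m n : ℕ} {x y : FreeLieAlgebra ℚ (Fin m)} (hx : x ∈ lieGrade m 1)
    (hy : y ∈ lieGrade m (n + 1)) : ⁅x, y⁆ ∈ lieGrade m (n + 2) :=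
  Submodule.subset_span ⟨x, hx, y, hy, rfl⟩

theorem of_mem_grade {m : ℕ} (a : Fin m) : FreeLieAlgebra.of ℚ a ∈ lieGrade m 1 :=
  Submodule.subset_span ⟨a, rfl⟩

theorem lie_mem_grade {m : ℕ} (k : ℕ) : ∀ (n : ℕ) (x y : FreeLieAlgebra ℚ (Fin m)),
    x ∈ lieGrade m (k + 1) → y ∈ lieGrade m (n + 1) → ⁅x, y⁆ ∈ lieGrade m (k + 1 + (n + 1)) := by
  induction k with
  | zero =>
    intro n x y hx hy
    rw [show 0 + 1 + (n + 1) = n + 2 by ring]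
    exact lie_mem_one hx hy
  | succ k ih =>
    intro n x y hx hy
    refine grade_ind_succ (P := fun x => ⁅x, y⁆ ∈ lieGrade m (k + 1 + 1 + (n + 1))) ?_ ?_ ?_ ?_ x hx
    · simp
    · intro a b ha hb; rw [add_lie]; exact Submodule.add_mem _ ha hb
    · intro c a ha; rw [smul_lie]; exact Submodule.smul_mem _ c ha
    · intro a z hz
      rw [lie_lie]
      apply Submodule.sub_mem
      · have h1 := ih n z y hz hy
        have h2 := lie_mem_one (n := k + 1 + n) (of_mem_grade a) h1
        convert h2 using 2
        ring
      · have h1 := lie_mem_one (of_mem_grade a) hy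
        have h2 := ih (n + 1) z _ hz h1
        convert h2 using 2
        ring

theorem wphi_hom {m : ℕ} (n : ℕ) : ∀ z ∈ lieGrade m (n + 1), WHom (n + 1) (wphi m z) := by
  have h0 : ∀ k : ℕ, WHom k (wphi m 0) := fun k w _ => by simp
  have hadd : ∀ k : ℕ, ∀ x y, WHom k (wphi m x) → WHom k (wphi m y) → WHom k (wphi m (x + y)) :=
    fun k x y hx hy w hw => by simp [hx w hw, hy w hw]
  have hsmul : ∀ k : ℕ, ∀ (c : ℚ) x, WHom k (wphi m x) → WHom k (wphi m (c • x)) :=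
    fun k c x hx w hw => by simp [hx w hw]
  induction n with
  | zero =>
    refine grade_ind_one (h0 _) (hadd _) (hsmul _) ?_
    intro a
    rw [wphi_of]
    exact WHom_WX a
  | succ n ih =>
    refine grade_ind_succ (h0 _) (hadd _) (hsmul _) ?_
    intro a y hy
    rw [wphi_lie, wphi_of]
    refine WHom_sub ?_ ?_
    · have := WHom_mul (WHom_WX a) (ih y hy)
      rwa [add_comm] at this
    · exact WHom_mul (ih y hy) (WHom_WX a)

theorem wphi_shuf {m : ℕ} (n : ℕ) : ∀ z ∈ lieGrade m (n + 1), ∀ u v, u ≠ [] → v ≠ [] →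
    shuf (fun w => cf w (wphi m z)) u v = 0 := by
  have h0 : ∀ u v, u ≠ [] → v ≠ [] → shuf (fun w => cf w (wphi m 0)) u v = 0 := by
    intro u v _ _; simp [shuf_zero]
  have hadd : ∀ x y : FreeLieAlgebra ℚ (Fin m),
      (∀ u v, u ≠ [] → v ≠ [] → shuf (fun w => cf w (wphi m x)) u v = 0) →
      (∀ u v, u ≠ [] → v ≠ [] → shuf (fun w => cf w (wphi m y)) u v = 0) →
      (∀ u v, u ≠ [] → v ≠ [] → shuf (fun w => cf w (wphi m (x + y))) u v = 0) := by
    intro x y hx hy u v hu hv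
    simp only [map_add]
    rw [shuf_add, hx u v hu hv, hy u v hu hv, add_zero]
  have hsmul : ∀ (c : ℚ) (x : FreeLieAlgebra ℚ (Fin m)),
      (∀ u v, u ≠ [] → v ≠ [] → shuf (fun w => cf w (wphi m x)) u v = 0) →
      (∀ u v, u ≠ [] → v ≠ [] → shuf (fun w => cf w (wphi m (c • x))) u v = 0) := by
    intro c x hx u v hu hv
    simp only [map_smul, smul_eq_mul]
    rw [shuf_smul, hx u v hu hv, mul_zero]
  induction n with
  | zero =>
    refine grade_ind_one h0 hadd hsmul ?_
    intro a u v hu hv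
    rcases u with _ | ⟨b, u⟩
    · exact absurd rfl hu
    rcases v with _ | ⟨c, v⟩
    · exact absurd rfl hv
    have h1 : ∀ (b : Fin m) (w u v : List (Fin m)), v ≠ [] →
        shuf (fun w => if b :: w = [a] then (1 : ℚ) else 0) u v = 0 := by
      intro b w u v hv
      rw [shuf]
      apply List.sum_eq_zero
      intro x hx
      obtain ⟨z, hz, rfl⟩ := List.mem_map.1 hx
      rw [if_neg]
      rintro h
      simp at h
      rcases mem_merges_cases hz with ⟨_, h2, _⟩ | ⟨_, _, _, _, h2, _⟩ | ⟨_, _, _, _, h2, _⟩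
      · exact hv h2
      · simp [h.2] at h2
      · simp [h.2] at h2
    have h2 : ∀ (b : Fin m) (w u v : List (Fin m)), u ≠ [] →
        shuf (fun w => if b :: w = [a] then (1 : ℚ) else 0) u v = 0 := by
      intro b w u v hv
      rw [shuf]
      apply List.sum_eq_zero
      intro x hx
      obtain ⟨z, hz, rfl⟩ := List.mem_map.1 hx
      rw [if_neg]
      rintro h
      simp at h
      rcases mem_merges_cases hz with ⟨h2, _, _⟩ | ⟨_, _, _, _, h2, _⟩ | ⟨_, _, _, _, h2, _⟩
      · exact hv h2
      · simp [h.2] at h2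
      · simp [h.2] at h2
    rw [shuf_cons]
    simp only [wphi_of, cf_WX]
    rw [h1 b [] u (c :: v) (by simp), h2 c [] (b :: u) v (by simp), add_zero]
  | succ n ih =>
    refine grade_ind_succ h0 hadd hsmul ?_
    intro a y hy u v hu hv
    simp only [wphi_lie, wphi_of, map_sub, cf_WX_mul, cf_mul_WX]
    simp only [sub_eq_add_neg]
    rw [shuf_add]
    have h1 := shuf_smul (-1) (rmulL a (fun z => cf z (wphi m y))) u v
    simp only [neg_mul, one_mul] at h1
    rw [h1, shuf_lmulL a _ (ih y hy) u v hu hv, shuf_rmulL a _ (ih y hy) u v hu hv, add_neg_cancel]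

/-- Right-normed bracketing. -/
noncomputable def wbrk {m : ℕ} : List (Fin m) → FreeLieAlgebra ℚ (Fin m)
  | [] => 0
  | [a] => FreeLieAlgebra.of ℚ a
  | a :: b :: w => ⁅FreeLieAlgebra.of ℚ a, wbrk (b :: w)⁆

/-- The Dynkin map. -/
noncomputable def wtheta (m : ℕ) : WT m →ₗ[ℚ] FreeLieAlgebra ℚ (Fin m) :=
  (Finsupp.linearCombination ℚ (fun w : FreeMonoid (Fin m) => wbrk (FreeMonoid.toList w))) ∘ₗ
    (MonoidAlgebra.coeffLinearEquiv ℚ).toLinearMap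

theorem wtheta_single {m : ℕ} (w : FreeMonoid (Fin m)) (r : ℚ) :
    wtheta m (MonoidAlgebra.single w r) = r • wbrk (FreeMonoid.toList w) := by
  simp [wtheta]

/-- The adjoint action of the tensor algebra. -/
noncomputable def wact (m : ℕ) : WT m →ₐ[ℚ] Module.End ℚ (FreeLieAlgebra ℚ (Fin m)) :=
  MonoidAlgebra.lift ℚ _ _ (FreeMonoid.lift
    (fun a => LieModule.toEnd ℚ _ (FreeLieAlgebra ℚ (Fin m)) (FreeLieAlgebra.of ℚ a)))

theorem wact_WX {m : ℕ} (a : Fin m) :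
    wact m (WX a) = LieModule.toEnd ℚ _ (FreeLieAlgebra ℚ (Fin m)) (FreeLieAlgebra.of ℚ a) := by
  simp [wact, WX]

theorem wact_phi {m : ℕ} (x y : FreeLieAlgebra ℚ (Fin m)) : wact m (wphi m x) y = ⁅x, y⁆ := by
  have h : (((wact m : WT m →ₗ⁅ℚ⁆ Module.End ℚ (FreeLieAlgebra ℚ (Fin m))).comp (wphi m))) =
      LieModule.toEnd ℚ (FreeLieAlgebra ℚ (Fin m)) (FreeLieAlgebra ℚ (Fin m)) := by
    apply FreeLieAlgebra.hom_ext
    intro a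
    change wact m (wphi m (FreeLieAlgebra.of ℚ a)) = _
    rw [wphi_of, wact_WX]
  have h2 := congrArg (fun f => f x y) h
  exact h2

theorem wtheta_mul_WX {m : ℕ} (a : Fin m) (p : WT m) :
    wtheta m (p * WX a) = wact m p (FreeLieAlgebra.of ℚ a) := by
  induction p using MonoidAlgebra.induction_linear with
  | zero => simp
  | add p q hp hq => simp [add_mul, hp, hq]
  | single w r =>
    rw [WX, MonoidAlgebra.single_mul_single, wtheta_single, mul_one, wact, MonoidAlgebra.lift_single,
      LinearMap.smul_apply]
    congr 1
    rw [FreeMonoid.toList_mul, FreeMonoid.toList_of]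
    induction w using FreeMonoid.inductionOn' with
    | one => simp [wbrk]
    | of_mul b w ih =>
      rw [FreeMonoid.toList_of_mul, map_mul, Module.End.mul_apply, FreeMonoid.lift_eval_of, ← ih]
      rcases hw : (FreeMonoid.toList w) with _ | ⟨c, l⟩
      · simp [wbrk]
      · simp [wbrk]

theorem wtheta_WX_mul {m : ℕ} (a : Fin m) (p : WT m) :
    wtheta m (WX a * p) = ⁅FreeLieAlgebra.of ℚ a, wtheta m p⁆ + cf [] p • FreeLieAlgebra.of ℚ a := by
  classical
  induction p using MonoidAlgebra.induction_linear with
  | zero => simp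
  | add p q hp hq => rw [mul_add, map_add, map_add, map_add, hp, hq, lie_add, add_smul]; abel
  | single w r =>
    rw [WX, MonoidAlgebra.single_mul_single, wtheta_single, one_mul, wtheta_single, cf_def,
      MonoidAlgebra.coeff_single_apply, FreeMonoid.toList_of_mul]
    rcases hw : (FreeMonoid.toList w) with _ | ⟨c, l⟩
    · have : w = FreeMonoid.ofList [] := hw
      rw [if_pos this]
      simp [wbrk]
    · have : w ≠ FreeMonoid.ofList [] := by
        rintro rfl
        simp at hw
      rw [if_neg this]
      simp [wbrk]

theorem wtheta_phi {m : ℕ} (n : ℕ) : ∀ z ∈ lieGrade m (n + 1),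
    wtheta m (wphi m z) = ((n : ℚ) + 1) • z := by
  induction n with
  | zero =>
    refine grade_ind_one (by simp) (fun x y hx hy => by simp_all) (fun c x hx => by simp_all) ?_
    intro a
    simp [wphi_of, WX, wtheta_single, wbrk]
  | succ n ih =>
    refine grade_ind_succ (by simp) (fun x y hx hy => by simp_all)
      (fun c x hx => by rw [map_smul, map_smul, hx, smul_comm]) ?_
    intro a y hy
    rw [wphi_lie, wphi_of, map_sub, wtheta_WX_mul, wtheta_mul_WX, wact_phi, ih y hy,
      wphi_hom n y hy [] (by simp), zero_smul, add_zero, lie_smul,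
      ← lie_skew y, sub_neg_eq_add]
    push_cast
    module

theorem wphi_inj {m : ℕ} (n : ℕ) (z) (hz : z ∈ lieGrade m (n + 1)) (h : wphi m z = 0) : z = 0 := by
  have h1 := wtheta_phi n z hz
  rw [h, map_zero] at h1
  have h2 : ((n : ℚ) + 1) ≠ 0 := by positivity
  exact (smul_eq_zero.1 h1.symm).resolve_left h2

/-- Each Lyndon word is the leading word of a Lie element. -/
theorem lyn_elem {m : ℕ} (n : ℕ) : ∀ w : List (Fin m), w.length ≤ n → IsLyn w →
    ∃ z ∈ lieGrade m w.length, cf w (wphi m z) = 1 ∧ ∀ v, v < w → cf v (wphi m z) = 0 := by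
  induction n with
  | zero => intro w hl h; exact absurd (List.length_eq_zero_iff.1 (by omega)) h.1
  | succ n ih =>
    intro w hl hw
    by_cases h2 : 2 ≤ w.length
    · obtain ⟨u, v, rfl, hu, hv⟩ := lyn_factor w hw h2
      have hup := List.length_pos_iff.2 hu.1
      have hvp := List.length_pos_iff.2 hv.1
      simp only [List.length_append] at hl
      obtain ⟨x, hx, hx1, hx2⟩ := ih u (by omega) hu
      obtain ⟨y, hy, hy1, hy2⟩ := ih v (by omega) hv
      have hvu : u ++ v < v ++ u := (lyn_iff_rot _ hw.1).1 hw u v hu.1 hv.1 rfl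
      have lead : ∀ (u v : List (Fin m)) (p q : WT m), WHom u.length p → WHom v.length q →
          (∀ z, z < u → cf z p = 0) → (∀ z, z < v → cf z q = 0) →
          ∀ z, z < u ++ v → cf z (p * q) = 0 := by
        intro u v p q hp hq h1 h2 z hz
        by_cases hlz : z.length = u.length + v.length
        · rw [cf_mul_hom p q hp z (by omega)]
          rcases lt_trichotomy (z.take u.length) u with h | h | h
          · rw [h1 _ h, zero_mul]
          · rw [h2, mul_zero]
            conv at hz => lhs; rw [← List.take_append_drop u.length z, h]
            exact (wapp_lt u).1 hz
          · have := wlt_app_of_length h (by simp) v (z.drop u.length)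
            rw [List.take_append_drop] at this
            exact absurd hz (not_lt.2 this.le)
        · exact WHom_mul hp hq z hlz
      have hxh : WHom u.length (wphi m x) := by
        have := wphi_hom (u.length - 1) x (by rwa [Nat.sub_add_cancel hup])
        rwa [Nat.sub_add_cancel hup] at this
      have hyh : WHom v.length (wphi m y) := by
        have := wphi_hom (v.length - 1) y (by rwa [Nat.sub_add_cancel hvp])
        rwa [Nat.sub_add_cancel hvp] at this
      refine ⟨⁅x, y⁆, ?_, ?_, ?_⟩
      · have := lie_mem_grade (u.length - 1) (v.length - 1) x y
          (by rwa [Nat.sub_add_cancel hup]) (by rwa [Nat.sub_add_cancel hvp])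
        rwa [Nat.sub_add_cancel hup, Nat.sub_add_cancel hvp, ← List.length_append] at this
      · rw [wphi_lie, map_sub, lead v u _ _ hyh hxh hy2 hx2 _ hvu, cf_mul_hom _ _ hxh _ (by simp)]
        simp [hx1, hy1]
      · intro z hz
        rw [wphi_lie, map_sub, lead v u _ _ hyh hxh hy2 hx2 _ (hz.trans hvu),
          lead u v _ _ hxh hyh hx2 hy2 _ hz, sub_zero]
    · rcases w with _ | ⟨a, _ | ⟨b, w⟩⟩
      · exact absurd rfl hw.1
      · refine ⟨FreeLieAlgebra.of ℚ a, of_mem_grade a, ?_, ?_⟩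
        · simp [wphi_of, cf_WX]
        · intro v hv
          rw [wphi_of, cf_WX, if_neg]
          rintro rfl
          exact lt_irrefl _ hv
      · simp at h2

end WittAlg

section WittDim

/-- Lyndon words of length `n`. -/
abbrev LynT (m n : ℕ) : Type := {w : List (Fin m) // w.length = n ∧ IsLyn w}

instance finite_words (m n : ℕ) : Finite {w : List (Fin m) // w.length = n} :=
  inferInstanceAs (Finite (List.Vector (Fin m) n))

instance finite_LynT (m n : ℕ) : Finite (LynT m n) :=
  Finite.of_injective (β := {w : List (Fin m) // w.length = n}) (fun w => ⟨w.1, w.2.1⟩)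
    (fun a b h => by
      have h1 := Subtype.mk.inj h
      exact Subtype.ext h1)

/-- Restriction to Lyndon coefficients. -/
noncomputable def lynMap (m n : ℕ) : lieGrade m n →ₗ[ℚ] (LynT m n → ℚ) :=
  LinearMap.pi (fun w => (cf w.1) ∘ₗ ((wphi m : FreeLieAlgebra ℚ (Fin m) →ₗ[ℚ] WT m)) ∘ₗ (lieGrade m n).subtype)

theorem lynMap_apply {m n : ℕ} (z : lieGrade m n) (w : LynT m n) :
    lynMap m n z w = cf w.1 (wphi m z.1) := rfl

theorem words_induction {m n : ℕ} {P : List (Fin m) → Prop}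
    (h : ∀ w, w.length = n → (∀ z, z.length = n → z < w → P z) → P w) :
    ∀ w, w.length = n → P w := by
  have wf : WellFounded ((· < ·) : {w : List (Fin m) // w.length = n} → {w : List (Fin m) // w.length = n} → Prop) :=
    Finite.wellFounded_of_trans_of_irrefl _
  intro w hw
  have := wf.induction (C := fun w => P w.1) ⟨w, hw⟩ (fun x ih => h x.1 x.2 (fun z hz hzx => ih ⟨z, hz⟩ hzx))
  exact this

theorem lynMap_inj (m n : ℕ) : Function.Injective (lynMap m (n + 1)) := by
  rw [← LinearMap.ker_eq_bot, LinearMap.ker_eq_bot']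
  rintro ⟨z, hz⟩ h
  apply Subtype.ext
  apply wphi_inj n z hz
  apply cf_ext
  intro w
  by_cases hw : w.length = n + 1
  · revert w
    apply words_induction
    intro w hw ih
    by_cases hl : IsLyn w
    · exact congrFun h ⟨w, hw, hl⟩
    · exact shuf_lead (fun w => cf w (wphi m z)) (wphi_shuf n z hz) w
        (by rintro rfl; simp at hw) hl (fun v hv hvw => ih v (hv.trans hw) hvw)
  · exact wphi_hom n z hz w hw

theorem lynMap_surj (m n : ℕ) : Function.Surjective (lynMap m (n + 1)) := by
  classical
  have := Fintype.ofFinite (LynT m (n + 1))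
  have key : ∀ w : LynT m (n + 1), Pi.single w (1 : ℚ) ∈ LinearMap.range (lynMap m (n + 1)) := by
    have wf : WellFounded ((· > ·) : LynT m (n + 1) → LynT m (n + 1) → Prop) :=
      Finite.wellFounded_of_trans_of_irrefl _
    intro w
    induction w using wf.induction with
    | _ w ih =>
    obtain ⟨z, hz, h1, h2⟩ := lyn_elem (n + 1) w.1 w.2.1.le w.2.2
    rw [w.2.1] at hz
    have e : (Pi.single w (1 : ℚ) : LynT m (n + 1) → ℚ) = lynMap m (n + 1) ⟨z, hz⟩
        - ∑ v ∈ Finset.univ.filter (fun v => v > w), cf v.1 (wphi m z) • Pi.single v (1 : ℚ) := by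
      funext v
      rw [Pi.sub_apply, Finset.sum_apply, lynMap_apply]
      simp only [Pi.smul_apply, Pi.single_apply, smul_eq_mul, mul_ite, mul_one, mul_zero]
      rw [Finset.sum_ite_eq]
      simp only [Finset.mem_filter, Finset.mem_univ, true_and]
      rcases lt_trichotomy v w with h | h | h
      · rw [if_neg h.ne, if_neg (not_lt.2 h.le), h2 v.1 h, sub_zero]
      · subst h
        rw [if_pos rfl, if_neg (lt_irrefl _), h1, sub_zero]
      · rw [if_neg h.ne', if_pos h, sub_self]
    rw [e]
    apply Submodule.sub_mem
    · exact ⟨_, rfl⟩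
    · apply Submodule.sum_mem
      intro v hv
      exact Submodule.smul_mem _ _ (ih v (Finset.mem_filter.1 hv).2)
  rw [← LinearMap.range_eq_top, eq_top_iff]
  intro f _
  rw [← Finset.univ_sum_single f]
  apply Submodule.sum_mem
  intro v _
  have : (Pi.single v (f v) : LynT m (n + 1) → ℚ) = f v • Pi.single v (1 : ℚ) := by
    rw [← Pi.single_smul]; simp
  rw [this]
  exact Submodule.smul_mem _ _ (key v)

theorem finrank_eq_card (m n : ℕ) :
    Module.finrank ℚ (lieGrade m (n + 1)) = Nat.card (LynT m (n + 1)) := by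
  classical
  have := Fintype.ofFinite (LynT m (n + 1))
  rw [(LinearEquiv.ofBijective _ ⟨lynMap_inj m n, lynMap_surj m n⟩).finrank_eq,
    Module.finrank_fintype_fun_eq_card, Nat.card_eq_fintype_card]

end WittDim

section WittCount

open Function

/-- The shift on sequences. -/
def wshift (m : ℕ) (f : ℕ → Fin m) : ℕ → Fin m := fun i => f (i + 1)

theorem wshift_iter {m : ℕ} (k : ℕ) (f : ℕ → Fin m) (i : ℕ) : (wshift m)^[k] f i = f (i + k) := by
  induction k generalizing f with
  | zero => rfl
  | succ k ih =>
    rw [Function.iterate_succ_apply, ih]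
    simp only [wshift]
    congr 1

/-- The periodic sequence of a word. -/
def wseq {m n : ℕ} (hn : 0 < n) (w : {w : List (Fin m) // w.length = n}) : ℕ → Fin m :=
  fun i => w.1[i % n]'(by rw [w.2]; exact Nat.mod_lt _ hn)

theorem wseq_inj {m n : ℕ} (hn : 0 < n) : Function.Injective (wseq (m := m) hn) := by
  intro w v h
  apply Subtype.ext
  apply List.ext_getElem (w.2.trans v.2.symm)
  intro i h1 h2
  have h3 := congrFun h i
  have h4 : i % n = i := Nat.mod_eq_of_lt (w.2 ▸ h1)
  simp only [wseq, h4] at h3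
  exact h3

/-- Rotation of words. -/
def wrot {m n : ℕ} (w : {w : List (Fin m) // w.length = n}) (k : ℕ) :
    {w : List (Fin m) // w.length = n} := ⟨w.1.rotate k, by rw [List.length_rotate, w.2]⟩

theorem wseq_rot {m n : ℕ} (hn : 0 < n) (w : {w : List (Fin m) // w.length = n}) (k : ℕ) :
    wseq hn (wrot w k) = (wshift m)^[k] (wseq hn w) := by
  funext i
  rw [wshift_iter]
  simp only [wseq, wrot, List.getElem_rotate, w.2, Nat.mod_add_mod]

theorem wseq_period {m n : ℕ} (hn : 0 < n) (w : {w : List (Fin m) // w.length = n}) :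
    IsPeriodicPt (wshift m) n (wseq hn w) := by
  funext i
  rw [wshift_iter]
  simp only [wseq, Nat.add_mod_right]

theorem wseq_surj {m n : ℕ} (hn : 0 < n) (f : ℕ → Fin m) (hf : IsPeriodicPt (wshift m) n f) :
    ∃ w, wseq hn w = f := by
  refine ⟨⟨List.ofFn (fun i : Fin n => f i), by simp⟩, ?_⟩
  have h : Function.Periodic f n := by
    intro i
    have := congrFun hf i
    rwa [wshift_iter] at this
  funext i
  simp only [wseq, List.getElem_ofFn]
  exact h.map_mod_nat i

theorem card_periodic (m n : ℕ) (hn : 0 < n) :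
    Nat.card {f : ℕ → Fin m // IsPeriodicPt (wshift m) n f} = m ^ n := by
  have e : {w : List (Fin m) // w.length = n} ≃ {f : ℕ → Fin m // IsPeriodicPt (wshift m) n f} :=
    Equiv.ofBijective (fun w => ⟨wseq hn w, wseq_period hn w⟩)
      ⟨fun a b h => wseq_inj hn (Subtype.mk.inj h), fun f => by
        obtain ⟨w, hw⟩ := wseq_surj hn f.1 f.2
        exact ⟨w, Subtype.ext hw⟩⟩
  rw [← Nat.card_congr e]
  have := card_vector (α := Fin m) n
  rw [Fintype.card_fin] at this
  rw [← this, ← Nat.card_eq_fintype_card]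
  rfl

theorem sum_prim (m n : ℕ) (hn : 0 < n) :
    ∑ d ∈ n.divisors, Nat.card {f : ℕ → Fin m // minimalPeriod (wshift m) f = d} = m ^ n := by
  classical
  rw [← card_periodic m n hn]
  have hfin : Finite {f : ℕ → Fin m // IsPeriodicPt (wshift m) n f} := by
    apply Finite.of_surjective
      (fun w : {w : List (Fin m) // w.length = n} =>
        (⟨wseq hn w, wseq_period hn w⟩ : {f : ℕ → Fin m // IsPeriodicPt (wshift m) n f}))
    intro f
    obtain ⟨w, hw⟩ := wseq_surj hn f.1 f.2
    exact ⟨w, Subtype.ext hw⟩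
  have hs : {f : ℕ → Fin m | IsPeriodicPt (wshift m) n f}.Finite := hfin
  have hc : Nat.card {f : ℕ → Fin m // IsPeriodicPt (wshift m) n f} = hs.toFinset.card :=
    Nat.subtype_card _ (by simp)
  rw [hc, Finset.card_eq_sum_card_fiberwise (f := fun f => minimalPeriod (wshift m) f)
    (t := n.divisors)]
  · apply Finset.sum_congr rfl
    intro d hd
    apply Nat.subtype_card
    intro f
    simp only [Finset.mem_filter, Set.Finite.mem_toFinset, Set.mem_setOf_eq]
    constructor
    · exact fun h => h.2
    · rintro rfl
      exact ⟨(isPeriodicPt_iff_minimalPeriod_dvd).2 (Nat.dvd_of_mem_divisors hd), rfl⟩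
  · intro f hf
    simp only [Finset.mem_coe, Set.Finite.mem_toFinset, Set.mem_setOf_eq] at hf
    simp only [Finset.mem_coe, Nat.mem_divisors]
    exact ⟨hf.minimalPeriod_dvd, hn.ne'⟩

theorem lyn_le_rot {m : ℕ} (w : List (Fin m)) (hw : IsLyn w) (k : ℕ) : w ≤ w.rotate k := by
  rw [← List.rotate_mod]
  have hk := Nat.mod_lt k (List.length_pos_iff.2 hw.1)
  generalize k % w.length = j at hk
  rcases Nat.eq_zero_or_pos j with rfl | hj
  · simp
  · rw [List.rotate_eq_drop_append_take hk.le]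
    refine ((lyn_iff_rot w hw.1).1 hw _ _ ?_ ?_ (List.take_append_drop j w).symm).le
    · rw [← List.length_pos_iff, List.length_take]; omega
    · rw [← List.length_pos_iff, List.length_drop]; omega

theorem lyn_rot_ne {m : ℕ} (w : List (Fin m)) (hw : IsLyn w) (k : ℕ) (hk : 0 < k)
    (hk2 : k < w.length) : w.rotate k ≠ w := by
  rw [List.rotate_eq_drop_append_take hk2.le]
  refine ((lyn_iff_rot w hw.1).1 hw _ _ ?_ ?_ (List.take_append_drop k w).symm).ne'
  · rw [← List.length_pos_iff, List.length_take]; omega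
  · rw [← List.length_pos_iff, List.length_drop]; omega

theorem lyn_minPeriod {m n : ℕ} (hn : 0 < n) (w : {w : List (Fin m) // w.length = n})
    (hw : IsLyn w.1) : minimalPeriod (wshift m) (wseq hn w) = n := by
  have h1 := (wseq_period hn w).minimalPeriod_dvd
  have h2 := (wseq_period hn w).minimalPeriod_pos hn
  rcases (Nat.le_of_dvd hn h1).lt_or_eq with h | h
  · exfalso
    have h3 : IsPeriodicPt (wshift m) _ (wseq hn w) := isPeriodicPt_minimalPeriod (wshift m) (wseq hn w)
    have h4 : wseq hn (wrot w (minimalPeriod (wshift m) (wseq hn w))) = wseq hn w := by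
      rw [wseq_rot]; exact h3
    have h5 := congrArg Subtype.val (wseq_inj hn h4)
    exact lyn_rot_ne w.1 hw _ h2 (by rw [w.2]; exact h) h5
  · exact h

theorem card_prim (m n : ℕ) (hn : 0 < n) :
    Nat.card {f : ℕ → Fin m // minimalPeriod (wshift m) f = n} = n * Nat.card (LynT m n) := by
  let F : Fin n × LynT m n → {f : ℕ → Fin m // minimalPeriod (wshift m) f = n} :=
    fun p => ⟨(wshift m)^[p.1.1] (wseq hn ⟨p.2.1, p.2.2.1⟩), by
      rw [minimalPeriod_apply_iterate ⟨n, hn, wseq_period hn _⟩]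
      exact lyn_minPeriod hn _ p.2.2.2⟩
  have hF : Function.Bijective F := by
    constructor
    · rintro ⟨k, w, hw, hwl⟩ ⟨j, v, hv, hvl⟩ h
      have h1 := Subtype.mk.inj h
      simp only at h1
      have h2 := h1
      rw [← wseq_rot, ← wseq_rot] at h2
      have h3 : w.rotate k.1 = v.rotate j.1 := congrArg Subtype.val (wseq_inj hn h2)
      have rot_back : ∀ (u : List (Fin m)), u.length = n → ∀ i : Fin n,
          (u.rotate i.1).rotate (n - i.1) = u := by
        intro u hu i
        rw [List.rotate_rotate, Nat.add_sub_cancel' i.2.le, ← hu, List.rotate_length]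
      have h4 : w ≤ v := by
        have := lyn_le_rot w hwl (k.1 + (n - j.1))
        rwa [← List.rotate_rotate, h3, rot_back v hv] at this
      have h5 : v ≤ w := by
        have := lyn_le_rot v hvl (j.1 + (n - k.1))
        rwa [← List.rotate_rotate, ← h3, rot_back w hw] at this
      obtain rfl := le_antisymm h4 h5
      have h6 := lyn_minPeriod hn ⟨w, hw⟩ hwl
      have h7 := iterate_injOn_Iio_minimalPeriod (f := wshift m) (x := wseq hn ⟨w, hw⟩)
        (x₁ := k.1) (by rw [h6]; exact k.2) (x₂ := j.1) (by rw [h6]; exact j.2) h1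
      rw [Fin.ext h7]
    · rintro ⟨f, hf⟩
      have hp : IsPeriodicPt (wshift m) n f := by
        have := isPeriodicPt_minimalPeriod (wshift m) f
        rwa [hf] at this
      obtain ⟨w, rfl⟩ := wseq_surj hn f hp
      have hw := w.2
      obtain ⟨k, hk, hmin⟩ := Finset.exists_min_image (Finset.range n) (fun k => w.1.rotate k)
        ⟨0, Finset.mem_range.2 hn⟩
      rw [Finset.mem_range] at hk
      have hmin' : ∀ j, w.1.rotate k ≤ w.1.rotate j := by
        intro j
        rw [← List.rotate_mod w.1 j, hw]
        exact hmin _ (Finset.mem_range.2 (Nat.mod_lt _ hn))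
      have hmp : minimalPeriod (wshift m) (wseq hn (wrot w k)) = n := by
        rw [wseq_rot, minimalPeriod_apply_iterate ⟨n, hn, hp⟩, hf]
      have hne : w.1.rotate k ≠ [] := by
        rw [← List.length_pos_iff, List.length_rotate, hw]; exact hn
      have hlyn : IsLyn (w.1.rotate k) := by
        rw [lyn_iff_rot _ hne]
        intro a b ha hb hab
        have hla := List.length_pos_iff.2 ha
        have hlb := List.length_pos_iff.2 hb
        have hlab : a.length + b.length = n := by
          rw [← List.length_append, ← hab, List.length_rotate, hw]
        have hr : b ++ a = (w.1.rotate k).rotate a.length := by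
          rw [hab, List.rotate_append_length_eq]
        refine lt_of_le_of_ne ?_ ?_
        · rw [hr, List.rotate_rotate]; exact hmin' _
        · intro he
          rw [hr] at he
          have h1 : wrot (wrot w k) a.length = wrot w k := Subtype.ext he.symm
          have h2 : IsPeriodicPt (wshift m) a.length (wseq hn (wrot w k)) := by
            have := wseq_rot hn (wrot w k) a.length
            rw [h1] at this
            exact this.symm
          have h3 := h2.minimalPeriod_le hla
          omega
      refine ⟨(⟨(n - k) % n, Nat.mod_lt _ hn⟩, ⟨w.1.rotate k, (wrot w k).2, hlyn⟩), ?_⟩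
      apply Subtype.ext
      change (wshift m)^[(n - k) % n] (wseq hn (wrot w k)) = wseq hn w
      rw [← wseq_rot]
      congr 1
      apply Subtype.ext
      change (w.1.rotate k).rotate ((n - k) % n) = w.1
      have h1 : (w.1.rotate k).length = n := (wrot w k).2
      have h2 := List.rotate_mod (w.1.rotate k) (n - k)
      rw [h1] at h2
      rw [h2, List.rotate_rotate, Nat.add_sub_cancel' hk.le]
      have h3 := List.rotate_length w.1
      rwa [hw] at h3
  rw [← Nat.card_congr (Equiv.ofBijective F hF), Nat.card_prod, Nat.card_fin]

theorem card_lyn_eq (m n : ℕ) (hn : 0 < n) : (Nat.card (LynT m n) : ℚ) = wittR m n := by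
  have h1 : ∀ n : ℕ, n > 0 → ∑ d ∈ n.divisors, ((d * Nat.card (LynT m d) : ℕ) : ℚ) = (m : ℚ) ^ n := by
    intro n hn
    rw [← Nat.cast_pow, ← sum_prim m n hn, Nat.cast_sum]
    apply Finset.sum_congr rfl
    intro d hd
    rw [card_prim m d (Nat.pos_of_mem_divisors hd)]
  have h2 := (ArithmeticFunction.sum_eq_iff_sum_mul_moebius_eq.1 h1) n hn
  rw [Nat.sum_divisorsAntidiagonal (fun a b => (ArithmeticFunction.moebius a : ℚ) * (m : ℚ) ^ b)] at h2
  rw [wittR, h2]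
  have : (n : ℚ) ≠ 0 := by exact_mod_cast hn.ne'
  push_cast
  field_simp

end WittCount

/-- The rank of the degree `n` part of the free Lie algebra over `ℚ` on `m` generators
equals the Witt number `R(m,n) = (1/n) Σ_{d ∣ n} μ(d) m^(n/d)`. -/
theorem finrank_lieGrade_eq_wittR (m n : ℕ) (hn : 1 ≤ n) :
    (Module.finrank ℚ (lieGrade m n) : ℚ) = wittR m n := by
  obtain ⟨k, rfl⟩ : ∃ k, n = k + 1 := ⟨n - 1, by omega⟩
  rw [finrank_eq_card, card_lyn_eq m (k + 1) (by omega)]
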